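/- Let c₀,…,c₇ ∈ ℂ^(2^4) be the orthonormal family c₀ = (|0000⟩+|1111⟩)/√2, c₁ = (|0110⟩+|1001⟩)/√2, c₂ = (|0101⟩+|1010⟩)/√2, c₃ = (|1100⟩+|0011⟩)/√2, c₄ = (|0001⟩−|1110⟩)/√2, c₅ = (|0010⟩−|1101⟩)/√2, c₆ = (|0100⟩−|1011⟩)/√2, c₇ = (|1000⟩−|0111⟩)/√2 (the basis of the ((4,8,1)) union code). Then for every position k ∈ {1,2,3,4}, the weight-one operators X_k (σx at position k and 𝟙 elsewhere) and Z_k (σz at position k and 𝟙 elsewhere) lie in the erasure space of this code: ⟪cᵢ, E cⱼ⟫ = 0 for all i ≠ j and ⟪cᵢ, E cᵢ⟫ = ⟪cⱼ, E cⱼ⟫ for all i, j, for E ∈ {X_k, Z_k}. -/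

import Mathlib

open scoped ComplexInnerProductSpace
open Matrix Complex

/-- The action of a matrix on the Hilbert space `EuclideanSpace ℂ (Fin n)`. -/
noncomputable def matApp {n : ℕ} (E : Matrix (Fin n) (Fin n) ℂ)
    (v : EuclideanSpace ℂ (Fin n)) : EuclideanSpace ℂ (Fin n) :=
  Matrix.toEuclideanLin E v

/-- The Pauli matrix σx. -/
def σx : Matrix (Fin 2) (Fin 2) ℂ := !![0, 1; 1, 0]
/-- The Pauli matrix σy. -/
def σy : Matrix (Fin 2) (Fin 2) ℂ := !![0, -I; I, 0]
/-- The Pauli matrix σz. -/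
def σz : Matrix (Fin 2) (Fin 2) ℂ := !![1, 0; 0, -1]

/-- The `k`-th bit (big-endian, `k = 0, …, 3`) of an index `i : Fin 16`,
identifying `i` with the four-qubit computational basis state `|b₁b₂b₃b₄⟩`
via `i = 8·b₁ + 4·b₂ + 2·b₃ + b₄`. -/
def bit4 (k : ℕ) (i : Fin 16) : Fin 2 :=
  ⟨i.val / 2 ^ (3 - k) % 2, Nat.mod_lt _ (by norm_num)⟩

/-- The Kronecker product `A₁ ⊗ A₂ ⊗ A₃ ⊗ A₄` of four `2 × 2` matrices,
written as a `16 × 16` matrix under the big-endian identification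
`Fin 16 ≃ (Fin 2)⁴`. -/
def kron4 (A₁ A₂ A₃ A₄ : Matrix (Fin 2) (Fin 2) ℂ) :
    Matrix (Fin 16) (Fin 16) ℂ :=
  Matrix.of fun i j =>
    A₁ (bit4 0 i) (bit4 0 j) * A₂ (bit4 1 i) (bit4 1 j) *
    A₃ (bit4 2 i) (bit4 2 j) * A₄ (bit4 3 i) (bit4 3 j)

/-- The four-qubit computational basis state `|b₁b₂b₃b₄⟩`. -/
noncomputable def ket4 (b₁ b₂ b₃ b₄ : Fin 2) : EuclideanSpace ℂ (Fin 16) :=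
  EuclideanSpace.single
    ⟨8 * b₁.val + 4 * b₂.val + 2 * b₃.val + b₄.val, by
      have h₁ := b₁.isLt; have h₂ := b₂.isLt
      have h₃ := b₃.isLt; have h₄ := b₄.isLt; omega⟩ 1

/-- The orthonormal basis `c₀, …, c₇` of the `((4,8,1))` union code:
`c₀, …, c₃` generate the `((4,4,2))` code of Grassl–Beth–Pellizzari and
`c₄, …, c₇` generate its image under `τ = 𝟙⊗𝟙⊗𝟙⊗σy`. -/
noncomputable def cGBP : Fin 8 → EuclideanSpace ℂ (Fin 16) :=
  ![(Real.sqrt 2 : ℂ)⁻¹ • (ket4 0 0 0 0 + ket4 1 1 1 1),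
    (Real.sqrt 2 : ℂ)⁻¹ • (ket4 0 1 1 0 + ket4 1 0 0 1),
    (Real.sqrt 2 : ℂ)⁻¹ • (ket4 0 1 0 1 + ket4 1 0 1 0),
    (Real.sqrt 2 : ℂ)⁻¹ • (ket4 1 1 0 0 + ket4 0 0 1 1),
    (Real.sqrt 2 : ℂ)⁻¹ • (ket4 0 0 0 1 - ket4 1 1 1 0),
    (Real.sqrt 2 : ℂ)⁻¹ • (ket4 0 0 1 0 - ket4 1 1 0 1),
    (Real.sqrt 2 : ℂ)⁻¹ • (ket4 0 1 0 0 - ket4 1 0 1 1),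
    (Real.sqrt 2 : ℂ)⁻¹ • (ket4 1 0 0 0 - ket4 0 1 1 1)]

/-- The transformation `τ = 𝟙 ⊗ 𝟙 ⊗ 𝟙 ⊗ σy`. -/
def τ₄ : Matrix (Fin 16) (Fin 16) ℂ := kron4 1 1 1 σy

/-- The erasure space `𝓔(C)` of the quantum code with basis `c`:
operators `E` with `⟪cᵢ, E cⱼ⟫ = 0` for `i ≠ j` and all diagonal entries
`⟪cᵢ, E cᵢ⟫` equal. -/
def erasureSpace {n K : ℕ} (c : Fin K → EuclideanSpace ℂ (Fin n)) :
    Set (Matrix (Fin n) (Fin n) ℂ) :=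
  {E | (∀ i j, i ≠ j → ⟪c i, matApp E (c j)⟫ = 0) ∧
       ∀ i j, ⟪c i, matApp E (c i)⟫ = ⟪c j, matApp E (c j)⟫}

/-- The weight-one operator with the Pauli matrix `P` at position `k` and the
identity elsewhere. -/
def pauliAt4 (P : Matrix (Fin 2) (Fin 2) ℂ) (k : Fin 4) :
    Matrix (Fin 16) (Fin 16) ℂ :=
  kron4 (if k = 0 then P else 1) (if k = 1 then P else 1)
    (if k = 2 then P else 1) (if k = 3 then P else 1)

/-- First ket index of each code word. -/
def idxA : Fin 8 → Fin 16 := ![0, 6, 5, 12, 1, 2, 4, 8]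

/-- Second ket index of each code word. -/
def idxB : Fin 8 → Fin 16 := ![15, 9, 10, 3, 14, 13, 11, 7]

/-- Relative sign of the two kets. -/
def sgnB : Fin 8 → ℤ := ![1, 1, 1, 1, -1, -1, -1, -1]

/-- Integer version of the weight-one operator. -/
def intPauli (P : Fin 2 → Fin 2 → ℤ) (k : Fin 4) (i j : Fin 16) : ℤ :=
  (if k = 0 then P else fun a b => if a = b then 1 else 0) (bit4 0 i) (bit4 0 j) *
  (if k = 1 then P else fun a b => if a = b then 1 else 0) (bit4 1 i) (bit4 1 j) *
  (if k = 2 then P else fun a b => if a = b then 1 else 0) (bit4 2 i) (bit4 2 j) *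
  (if k = 3 then P else fun a b => if a = b then 1 else 0) (bit4 3 i) (bit4 3 j)

/-- Integer version of σx. -/
def intX : Fin 2 → Fin 2 → ℤ := fun a b => if a = b then 0 else 1

/-- Integer version of σz. -/
def intZ : Fin 2 → Fin 2 → ℤ := fun a b => if a = b then (if a = 0 then 1 else -1) else 0

/-- Integer version of the matrix element (without normalization). -/
def intElem (M : Fin 16 → Fin 16 → ℤ) (i j : Fin 8) : ℤ :=
  M (idxA i) (idxA j) + sgnB j * M (idxA i) (idxB j) +
    sgnB i * M (idxB i) (idxA j) + sgnB i * sgnB j * M (idxB i) (idxB j)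

lemma cGBP_eq (i : Fin 8) : cGBP i = (Real.sqrt 2 : ℂ)⁻¹ •
    (EuclideanSpace.single (idxA i) (1 : ℂ) +
      (sgnB i : ℂ) • EuclideanSpace.single (idxB i) (1 : ℂ)) := by
  fin_cases i <;> simp [cGBP, ket4, idxA, idxB, sgnB, sub_eq_add_neg]

lemma pauliAt4_apply (P : Matrix (Fin 2) (Fin 2) ℂ) (Q : Fin 2 → Fin 2 → ℤ)
    (h : ∀ a b, P a b = (Q a b : ℂ)) (k : Fin 4) (i j : Fin 16) :
    pauliAt4 P k i j = (intPauli Q k i j : ℂ) := by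
  have key : ∀ (p : Prop) [Decidable p] (a b : Fin 2),
      (if p then P else 1) a b =
        (((if p then Q else fun a b => if a = b then 1 else 0) a b : ℤ) : ℂ) := by
    intro p _ a b
    by_cases hp : p
    · simp [hp, h]
    · rw [if_neg hp, if_neg hp, Matrix.one_apply]
      by_cases hab : a = b <;> simp [hab]
  simp only [pauliAt4, kron4, Matrix.of_apply, intPauli, Int.cast_mul, key]

lemma inner_single_matApp (E : Matrix (Fin 16) (Fin 16) ℂ) (a b : Fin 16) :
    ⟪EuclideanSpace.single a (1 : ℂ), matApp E (EuclideanSpace.single b (1 : ℂ))⟫ = E a b := by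
  simp [matApp, EuclideanSpace.inner_single_left]

lemma inner_cGBP (E : Matrix (Fin 16) (Fin 16) ℂ) (M : Fin 16 → Fin 16 → ℤ)
    (h : ∀ a b, E a b = (M a b : ℂ)) (i j : Fin 8) (h0 : intElem M i j = 0) :
    ⟪cGBP i, matApp E (cGBP j)⟫ = 0 := by
  have hadd : ∀ v w, matApp E (v + w) = matApp E v + matApp E w := fun v w => map_add _ v w
  have hsmul : ∀ (c : ℂ) v, matApp E (c • v) = c • matApp E v := fun c v => map_smul _ c v
  have h1 : ((intElem M i j : ℤ) : ℂ) = 0 := by rw [h0]; simp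
  rw [cGBP_eq, cGBP_eq]
  simp only [hadd, hsmul, inner_add_left, inner_add_right, inner_smul_left, inner_smul_right,
    inner_single_matApp, h]
  simp only [intElem, Int.cast_add, Int.cast_mul] at h1
  rw [show (starRingEnd ℂ) (sgnB i : ℂ) = (sgnB i : ℂ) from by simp]
  linear_combination ((Real.sqrt 2 : ℂ)⁻¹ * (starRingEnd ℂ) ((Real.sqrt 2 : ℂ)⁻¹)) * h1

lemma intElem_X : ∀ k i j, intElem (intPauli intX k) i j = 0 := by decide +kernel

lemma intElem_Z : ∀ k i j, intElem (intPauli intZ k) i j = 0 := by decide +kernel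

/-- For every position `k`, the weight-one operators `X_k` (σx at position `k`)
and `Z_k` (σz at position `k`) lie in the erasure space of the `((4,8,1))`
union code with basis `c₀, …, c₇`. -/
theorem gbp_union_weight_one_X_Z_mem_erasureSpace (k : Fin 4)
    (E : Matrix (Fin 16) (Fin 16) ℂ)
    (hE : E = pauliAt4 σx k ∨ E = pauliAt4 σz k) :
    E ∈ erasureSpace cGBP := by
  have hz : ∀ i j, ⟪cGBP i, matApp E (cGBP j)⟫ = 0 := by
    intro i j
    rcases hE with rfl | rfl
    · refine inner_cGBP _ (intPauli intX k) (pauliAt4_apply σx intX ?_ k) i j (intElem_X k i j)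
      intro a b
      fin_cases a <;> fin_cases b <;> simp [σx, intX]
    · refine inner_cGBP _ (intPauli intZ k) (pauliAt4_apply σz intZ ?_ k) i j (intElem_Z k i j)
      intro a b
      fin_cases a <;> fin_cases b <;> simp [σz, intZ]
  exact ⟨fun i j _ => hz i j, fun i j => by rw [hz, hz]⟩
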